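/- arXiv:0711.0979 — 2 statements merged into one kernel-verified Lean document; each statement's English description precedes it below -/
import Mathlib

section
/- Let 1 ≤ p < n, let α ∈ ℝ^p be a Diophantine vector, let C be an (n−p)×p integer matrix, let B ∈ GL(n−p,ℤ) be quasi-unipotent, and let F : ℝ^p → ℝ^{n−p} be a C^∞ ℤ^p-periodic map. Let φ be the diffeomorphism of T^n = ℝ^n/ℤ^n defined by the lift Φ(X,Y) = (X + α, CX + BY + F(X)). Set β = ∫_{[0,1]^p} F(X) dX and let β₁ be the orthogonal projection of β onto ker((I − B)^T). Then there exists a C^∞ ℤ^p-periodic map G : ℝ^p → ℝ^{n−p} such that the diffeomorphism h of T^n with lift (X,Y) ↦ (X, Y + G(X)) satisfies h ∘ φ = φ₀ ∘ h, where φ₀ is the affine diffeomorphism of T^n with lift (X,Y) ↦ (X + α, CX + BY + β₁). -/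
open Matrix

/-- The torus `T^n = T^p × T^{n-p}` with `q = n - p`, as a product of circles. -/
abbrev Torus2 (p q : ℕ) := (Fin p → AddCircle (1 : ℝ)) × (Fin q → AddCircle (1 : ℝ))

/-- The canonical projection `ℝ^p × ℝ^q → T^p × T^q`. -/
noncomputable def torusProj2 (p q : ℕ) (z : (Fin p → ℝ) × (Fin q → ℝ)) : Torus2 p q :=
  (fun i => (z.1 i : AddCircle (1 : ℝ)), fun i => (z.2 i : AddCircle (1 : ℝ)))

/-- A vector `α ∈ ℝ^p` is Diophantine: `‖⟨k,α⟩‖ ≥ c·|k|^{−r}` for all `k ∈ ℤ^p∖{0}`. -/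
def IsDiophantine {p : ℕ} (α : Fin p → ℝ) : Prop :=
  ∃ c > (0:ℝ), ∃ r > (0:ℝ), ∀ k : Fin p → ℤ, k ≠ 0 → ∀ m : ℤ,
    c * ‖(fun i => (k i : ℝ))‖ ^ (-r) ≤ |(∑ i, (k i : ℝ) * α i) - (m : ℝ)|

open MeasureTheory Set

section CubeMean

variable {p : ℕ} {E : Type*}

/-- A function on `ℝ^p` is `ℤ^p`-periodic. -/
def IsZPeriodic (f : (Fin p → ℝ) → E) : Prop :=
  ∀ (X : Fin p → ℝ) (ℓ : Fin p → ℤ), f (X + fun i => (ℓ i : ℝ)) = f X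

/-- The function on the torus induced by a function on `ℝ^p`, meaningful for periodic functions. -/
noncomputable def torusDescend (f : (Fin p → ℝ) → E) (y : UnitAddTorus (Fin p)) : E :=
  f fun i => Quotient.out (y i)

theorem IsZPeriodic.torusDescend_coe {f : (Fin p → ℝ) → E} (hf : IsZPeriodic f)
    (x : Fin p → ℝ) : torusDescend f (fun i => (x i : UnitAddCircle)) = f x := by
  have h : ∀ i, ∃ n : ℤ, Quotient.out (x i : UnitAddCircle) = x i + n := by
    intro i
    have h1 : ((Quotient.out (x i : UnitAddCircle) : ℝ) : UnitAddCircle) = (x i : UnitAddCircle) :=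
      Quotient.out_eq' _
    rw [eq_comm, QuotientAddGroup.eq, AddSubgroup.mem_zmultiples_iff] at h1
    obtain ⟨n, hn⟩ := h1
    refine ⟨n, ?_⟩
    simp only [zsmul_eq_mul, mul_one] at hn
    linarith
  choose n hn using h
  rw [torusDescend, funext hn]
  exact hf x n

theorem IsZPeriodic.continuous_torusDescend [TopologicalSpace E] {f : (Fin p → ℝ) → E}
    (hf : IsZPeriodic f) (hc : Continuous f) : Continuous (torusDescend f) := by
  have hq : IsOpenQuotientMap (Pi.map fun (_ : Fin p) (t : ℝ) => (t : UnitAddCircle)) :=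
    IsOpenQuotientMap.piMap fun _ => QuotientAddGroup.isOpenQuotientMap_mk
  rw [← hq.continuous_comp_iff]
  convert hc using 1
  ext x
  exact hf.torusDescend_coe x

theorem IsZPeriodic.exists_norm_le [NormedAddCommGroup E] {f : (Fin p → ℝ) → E}
    (hf : IsZPeriodic f) (hc : Continuous f) : ∃ C, ∀ x, ‖f x‖ ≤ C := by
  obtain ⟨C, hC⟩ := isCompact_univ.exists_bound_of_continuousOn
    (hf.continuous_torusDescend hc).continuousOn
  refine ⟨C, fun x => ?_⟩
  rw [← hf.torusDescend_coe x]
  exact hC _ trivial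

theorem isCompact_unitCube : IsCompact (Set.univ.pi (fun _ : Fin p => Set.Icc (0 : ℝ) 1)) :=
  isCompact_univ_pi fun _ => isCompact_Icc

theorem integrableOn_unitCube [NormedAddCommGroup E] {f : (Fin p → ℝ) → E} (hf : Continuous f) :
    IntegrableOn f (Set.univ.pi (fun _ : Fin p => Set.Icc (0 : ℝ) 1)) :=
  hf.continuousOn.integrableOn_compact isCompact_unitCube

variable [NormedAddCommGroup E] [NormedSpace ℝ E]

/-- The integral over the unit cube. -/
noncomputable def cubeMean (f : (Fin p → ℝ) → E) : E :=
  ∫ X in Set.univ.pi (fun _ : Fin p => Set.Icc (0 : ℝ) 1), f X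

theorem volume_unitCube : volume (Set.univ.pi (fun _ : Fin p => Set.Icc (0 : ℝ) 1)) = 1 := by
  rw [volume_pi_pi]; simp

theorem cubeMean_const [CompleteSpace E] (c : E) : cubeMean (fun _ : Fin p → ℝ => c) = c := by
  rw [cubeMean, setIntegral_const, measureReal_def, volume_unitCube, ENNReal.toReal_one, one_smul]

theorem norm_cubeMean_le {f : (Fin p → ℝ) → E} {C : ℝ} (hC : ∀ x, ‖f x‖ ≤ C) :
    ‖cubeMean f‖ ≤ C := by
  have := norm_setIntegral_le_of_norm_le_const (μ := volume) (f := f) (C := C)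
    (s := Set.univ.pi (fun _ : Fin p => Set.Icc (0 : ℝ) 1)) (by rw [volume_unitCube]; simp)
    (fun x _ => hC x)
  rwa [measureReal_def, volume_unitCube, ENNReal.toReal_one, mul_one] at this

theorem cubeMean_add {f g : (Fin p → ℝ) → E} (hf : Continuous f) (hg : Continuous g) :
    cubeMean (fun x => f x + g x) = cubeMean f + cubeMean g :=
  integral_add (integrableOn_unitCube hf) (integrableOn_unitCube hg)

theorem cubeMean_sub {f g : (Fin p → ℝ) → E} (hf : Continuous f) (hg : Continuous g) :
    cubeMean (fun x => f x - g x) = cubeMean f - cubeMean g :=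
  integral_sub (integrableOn_unitCube hf) (integrableOn_unitCube hg)

theorem cubeMean_comp {E' : Type*} [NormedAddCommGroup E'] [NormedSpace ℝ E'] [CompleteSpace E]
    [CompleteSpace E'] (L : E →L[ℝ] E') {f : (Fin p → ℝ) → E} (hf : Continuous f) :
    cubeMean (fun x => L (f x)) = L (cubeMean f) :=
  L.integral_comp_comm (integrableOn_unitCube hf)

theorem cubeMean_eq_setIntegral_Ioc (f : (Fin p → ℝ) → E) :
    cubeMean f = ∫ x in {x : Fin p → ℝ | ∀ i, x i ∈ Ioc ((0 : Fin p → ℝ) i)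
      ((0 : Fin p → ℝ) i + 1)}, f x := by
  refine (setIntegral_congr_set ?_).symm
  have h := Measure.univ_pi_Ioc_ae_eq_Icc (μ := fun _ : Fin p => (volume : Measure ℝ))
    (f := fun _ => 0) (g := fun _ => 1)
  rw [← pi_univ_Icc] at h
  have h' : {x : Fin p → ℝ | ∀ i, x i ∈ Ioc ((0 : Fin p → ℝ) i) ((0 : Fin p → ℝ) i + 1)}
      = Set.univ.pi fun _ => Ioc (0 : ℝ) 1 := by
    ext x
    simp [Set.mem_pi]
  rw [h']
  exact h

theorem IsZPeriodic.cubeMean_eq {f : (Fin p → ℝ) → E} (hf : IsZPeriodic f) (a : Fin p → ℝ) :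
    cubeMean f = ∫ x in {x : Fin p → ℝ | ∀ i, x i ∈ Ioc (a i) (a i + 1)}, f x := by
  have h := (UnitAddTorus.integral_preimage (torusDescend f) 0).symm.trans
    (UnitAddTorus.integral_preimage (torusDescend f) a)
  simp_rw [hf.torusDescend_coe] at h
  rw [cubeMean_eq_setIntegral_Ioc, h]

theorem IsZPeriodic.cubeMean_translate {f : (Fin p → ℝ) → E} (hf : IsZPeriodic f)
    (v : Fin p → ℝ) : cubeMean (fun x => f (x + v)) = cubeMean f := by
  rw [hf.cubeMean_eq v, cubeMean_eq_setIntegral_Ioc,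
    ← (measurePreserving_add_right volume v).setIntegral_preimage_emb
      (measurableEmbedding_addRight v) f]
  congr 2
  ext x
  refine forall_congr' fun i => ?_
  simp only [Pi.zero_apply, Pi.add_apply, mem_Ioc]
  constructor <;> rintro ⟨h1, h2⟩ <;> constructor <;> linarith

theorem IsZPeriodic.fderiv_apply {f : (Fin p → ℝ) → E} (hf : IsZPeriodic f) (v : Fin p → ℝ) :
    IsZPeriodic (fun x => fderiv ℝ f x v) := by
  intro X ℓ
  have h : (fun x => f (x + fun i => (ℓ i : ℝ))) = f := funext fun x => hf x ℓ
  have := fderiv_comp_add_right (𝕜 := ℝ) (f := f) (x := X) (fun i => (ℓ i : ℝ))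
  rw [h] at this
  simp only [this]

theorem ContDiff.fderiv_apply_const {f : (Fin p → ℝ) → E} (hf : ContDiff ℝ (⊤ : ℕ∞) f)
    (v : Fin p → ℝ) : ContDiff ℝ (⊤ : ℕ∞) (fun x => fderiv ℝ f x v) :=
  (hf.fderiv_right (m := (⊤ : ℕ∞)) (by simp)).clm_apply contDiff_const

theorem IsZPeriodic.cubeMean_fderiv [CompleteSpace E] {f : (Fin p → ℝ) → E} (hf : IsZPeriodic f)
    (hs : ContDiff ℝ (⊤ : ℕ∞) f) (v : Fin p → ℝ) : cubeMean (fun x => fderiv ℝ f x v) = 0 := by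
  obtain ⟨C, hC⟩ := (hf.fderiv_apply v).exists_norm_le (hs.fderiv_apply_const v).continuous
  have hd : ∀ (x : Fin p → ℝ) (t : ℝ),
      HasDerivAt (fun t : ℝ => f (x + t • v)) (fderiv ℝ f (x + t • v) v) t := by
    intro x t
    have h1 : HasDerivAt (fun t : ℝ => x + t • v) v t := by
      simpa using ((hasDerivAt_id t).smul_const v).const_add x
    exact ((hs.differentiable (by simp)) _).hasFDerivAt.comp_hasDerivAt t h1
  have key := hasDerivAt_integral_of_dominated_loc_of_deriv_le (𝕜 := ℝ)
    (μ := volume.restrict (Set.univ.pi (fun _ : Fin p => Set.Icc (0 : ℝ) 1)))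
    (F := fun (t : ℝ) (x : Fin p → ℝ) => f (x + t • v))
    (F' := fun (t : ℝ) (x : Fin p → ℝ) => fderiv ℝ f (x + t • v) v)
    (x₀ := 0) (s := univ) (bound := fun _ => C) Filter.univ_mem
    (Filter.Eventually.of_forall fun t =>
      (hs.continuous.comp (continuous_id.add continuous_const)).aestronglyMeasurable)
    (integrableOn_unitCube (hs.continuous.comp (continuous_id.add continuous_const)))
    (((hs.fderiv_apply_const v).continuous.comp
      (continuous_id.add continuous_const)).aestronglyMeasurable)
    (Filter.Eventually.of_forall fun x t _ => hC _)
    (integrableOn_unitCube continuous_const)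
    (Filter.Eventually.of_forall fun x t _ => hd x t)
  have h2 := key.2
  have h3 : (fun t : ℝ => ∫ x in Set.univ.pi (fun _ : Fin p => Set.Icc (0 : ℝ) 1), f (x + t • v))
      = fun _ => cubeMean f := funext fun t => hf.cubeMean_translate (t • v)
  rw [h3] at h2
  have h4 := h2.unique (hasDerivAt_const _ _)
  simpa [cubeMean] using h4

end CubeMean

section Fourier

open Complex
open scoped Real

variable {p : ℕ}

/-- The linear form `x ↦ ⟨k, x⟩` on `ℝ^p` attached to an integer vector `k`. -/
noncomputable def intForm (k : Fin p → ℤ) : (Fin p → ℝ) →L[ℝ] ℝ :=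
  ∑ i, (k i : ℝ) • ContinuousLinearMap.proj (R := ℝ) (φ := fun _ : Fin p => ℝ) i

theorem intForm_apply (k : Fin p → ℤ) (x : Fin p → ℝ) : intForm k x = ∑ i, (k i : ℝ) * x i := by
  simp [intForm]

theorem intForm_int (k ℓ : Fin p → ℤ) :
    intForm k (fun i => (ℓ i : ℝ)) = ((∑ i, k i * ℓ i : ℤ) : ℝ) := by
  simp [intForm_apply]

theorem norm_intForm_le (k : Fin p → ℤ) : ‖intForm k‖ ≤ p * ‖fun i => (k i : ℝ)‖ := by
  refine ContinuousLinearMap.opNorm_le_bound _ (by positivity) fun x => ?_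
  rw [intForm_apply]
  calc ‖∑ i, (k i : ℝ) * x i‖ ≤ ∑ i : Fin p, ‖fun i => (k i : ℝ)‖ * ‖x‖ := by
        refine norm_sum_le_of_le _ fun i _ => ?_
        rw [norm_mul]
        gcongr
        · exact norm_le_pi_norm (fun i => (k i : ℝ)) i
        · exact norm_le_pi_norm x i
    _ = _ := by simp [mul_assoc]

/-- The character `x ↦ exp (2 * π * i * ⟨k, x⟩)`. -/
noncomputable def torusChar (k : Fin p → ℤ) (x : Fin p → ℝ) : ℂ :=
  cexp (2 * π * I * (intForm k x : ℝ))

theorem norm_torusChar (k : Fin p → ℤ) (x : Fin p → ℝ) : ‖torusChar k x‖ = 1 := by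
  have : (2 * π * I * (intForm k x : ℝ) : ℂ) = ((2 * π * intForm k x : ℝ) : ℂ) * I := by
    push_cast; ring
  rw [torusChar, this, Complex.norm_exp_ofReal_mul_I]

theorem torusChar_add (k : Fin p → ℤ) (x y : Fin p → ℝ) :
    torusChar k (x + y) = torusChar k x * torusChar k y := by
  rw [torusChar, torusChar, torusChar, ← Complex.exp_add, map_add]
  congr 1
  push_cast
  ring

theorem torusChar_int (k ℓ : Fin p → ℤ) : torusChar k (fun i => (ℓ i : ℝ)) = 1 := by
  rw [torusChar, intForm_int, Complex.exp_eq_one_iff]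
  exact ⟨∑ i, k i * ℓ i, by push_cast; ring⟩

theorem isZPeriodic_torusChar (k : Fin p → ℤ) : IsZPeriodic (torusChar k) := by
  intro X ℓ
  rw [torusChar_add, torusChar_int, mul_one]

theorem mFourier_coe (k : Fin p → ℤ) (x : Fin p → ℝ) :
    UnitAddTorus.mFourier k (fun i => (x i : UnitAddCircle)) = torusChar k x := by
  simp only [UnitAddTorus.mFourier, ContinuousMap.coe_mk, fourier_coe_apply, torusChar,
    intForm_apply]
  rw [← Complex.exp_sum]
  congr 1
  push_cast
  rw [Finset.mul_sum]
  refine Finset.sum_congr rfl fun i _ => ?_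
  simp
  ring

theorem fderiv_torusChar_apply (k : Fin p → ℤ) (x v : Fin p → ℝ) :
    fderiv ℝ (torusChar k) x v = 2 * π * I * intForm k v * torusChar k x := by
  have h1 : HasFDerivAt (fun x : Fin p → ℝ => (2 * π * I * (intForm k x : ℝ) : ℂ))
      ((2 * π * I : ℂ) • (Complex.ofRealCLM.comp (intForm k))) x :=
    ((Complex.ofRealCLM.comp (intForm k)).hasFDerivAt).const_mul _
  have h2 := h1.cexp
  have h3 : fderiv ℝ (torusChar k) x = _ := h2.fderiv
  rw [h3]
  simp [torusChar]
  ring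

theorem contDiff_torusChar (k : Fin p → ℤ) {n : WithTop ℕ∞} : ContDiff ℝ n (torusChar k) :=
  (Complex.contDiff_exp (𝕜 := ℝ)).comp
    (contDiff_const.mul (Complex.ofRealCLM.contDiff.comp (intForm k).contDiff))

theorem iteratedDeriv_cexp_ofReal (c : ℂ) (n : ℕ) :
    iteratedDeriv n (fun t : ℝ => cexp (c * t)) = fun t : ℝ => c ^ n * cexp (c * t) := by
  induction n with
  | zero => simp
  | succ n ih =>
    rw [iteratedDeriv_succ, ih]
    ext t
    have h : HasDerivAt (fun t : ℝ => cexp (c * t)) (cexp (c * t) * (c * 1)) t :=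
      (((hasDerivAt_id (t : ℂ)).const_mul c).cexp).comp_ofReal
    rw [(h.const_mul (c ^ n)).deriv]
    ring

theorem norm_iteratedFDeriv_torusChar_le (k : Fin p → ℤ) (n : ℕ) (x : Fin p → ℝ) :
    ‖iteratedFDeriv ℝ n (torusChar k) x‖ ≤ (2 * π * p * ‖fun i => (k i : ℝ)‖) ^ n := by
  have hg : ContDiff ℝ n (fun t : ℝ => cexp (2 * π * I * t)) :=
    (Complex.contDiff_exp (𝕜 := ℝ)).comp
      (contDiff_const.mul Complex.ofRealCLM.contDiff)
  have h := (intForm k).iteratedFDeriv_comp_right hg x (i := n) le_rfl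
  have hk : torusChar k = (fun t : ℝ => cexp (2 * π * I * t)) ∘ (intForm k) := rfl
  rw [hk, h]
  refine (ContinuousMultilinearMap.norm_compContinuousLinearMap_le _ _).trans ?_
  rw [norm_iteratedFDeriv_eq_norm_iteratedDeriv, iteratedDeriv_cexp_ofReal]
  have h1 : ‖cexp (2 * π * I * (intForm k x : ℝ))‖ = 1 := norm_torusChar k x
  rw [norm_mul, h1, Finset.prod_const, Finset.card_univ, Fintype.card_fin, mul_one, norm_pow,
    ← mul_pow]
  have h2 : ‖(2 * π * I : ℂ)‖ = 2 * π := by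
    simp [abs_of_pos Real.pi_pos]
  rw [h2, mul_assoc (2 * π)]
  gcongr
  exact norm_intForm_le k

/-- The Fourier coefficients of a periodic function on `ℝ^p`. -/
noncomputable def cubeCoeff (f : (Fin p → ℝ) → ℂ) (k : Fin p → ℤ) : ℂ :=
  cubeMean fun x => torusChar (-k) x * f x

theorem IsZPeriodic.mFourierCoeff_torusDescend {f : (Fin p → ℝ) → ℂ} (hf : IsZPeriodic f)
    (k : Fin p → ℤ) : UnitAddTorus.mFourierCoeff (torusDescend f) k = cubeCoeff f k := by
  rw [UnitAddTorus.mFourierCoeff_eq_integral _ _ 0, cubeCoeff, cubeMean_eq_setIntegral_Ioc]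
  simp_rw [hf.torusDescend_coe, mFourier_coe, smul_eq_mul]

theorem IsZPeriodic.hasSum_cubeCoeff {f : (Fin p → ℝ) → ℂ} (hf : IsZPeriodic f)
    (hc : Continuous f) (h : Summable (cubeCoeff f)) (x : Fin p → ℝ) :
    HasSum (fun k => cubeCoeff f k * torusChar k x) (f x) := by
  have he : UnitAddTorus.mFourierCoeff (torusDescend f) = cubeCoeff f :=
    funext hf.mFourierCoeff_torusDescend
  have := UnitAddTorus.hasSum_mFourier_series_apply_of_summable
    (f := ⟨torusDescend f, hf.continuous_torusDescend hc⟩) (by simpa [he] using h)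
    (fun i => (x i : UnitAddCircle))
  simpa [he, mFourier_coe, hf.torusDescend_coe] using this

theorem norm_cubeCoeff_le {f : (Fin p → ℝ) → ℂ} {C : ℝ} (hC : ∀ x, ‖f x‖ ≤ C)
    (k : Fin p → ℤ) : ‖cubeCoeff f k‖ ≤ C :=
  norm_cubeMean_le fun x => by rw [norm_mul, norm_torusChar, one_mul]; exact hC x

theorem cubeCoeff_zero (f : (Fin p → ℝ) → ℂ) : cubeCoeff f 0 = cubeMean f := by
  simp [cubeCoeff, torusChar, intForm]

theorem IsZPeriodic.cubeCoeff_fderiv {f : (Fin p → ℝ) → ℂ} (hf : IsZPeriodic f)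
    (hs : ContDiff ℝ (⊤ : ℕ∞) f) (k : Fin p → ℤ) (v : Fin p → ℝ) :
    cubeCoeff (fun x => fderiv ℝ f x v) k = 2 * π * I * intForm k v * cubeCoeff f k := by
  have hper : IsZPeriodic (fun x => torusChar (-k) x * f x) := fun X ℓ => by
    simp only [isZPeriodic_torusChar (-k) X ℓ, hf X ℓ]
  have hχ : ContDiff ℝ (⊤ : ℕ∞) (torusChar (-k)) := contDiff_torusChar (-k)
  have hsm : ContDiff ℝ (⊤ : ℕ∞) (fun x => torusChar (-k) x * f x) := hχ.mul hs
  have h0 := hper.cubeMean_fderiv hsm v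
  have hd : (fun x => fderiv ℝ (fun x => torusChar (-k) x * f x) x v) = fun x =>
      torusChar (-k) x * fderiv ℝ f x v
        - (2 * π * I * intForm k v) * (torusChar (-k) x * f x) := by
    ext x
    have h1 := ((hχ.differentiable (by simp)) x).hasFDerivAt.mul
      ((hs.differentiable (by simp)) x).hasFDerivAt
    have h2 : fderiv ℝ (fun x => torusChar (-k) x * f x) x = _ := h1.fderiv
    have h3 : intForm (-k) v = - intForm k v := by simp [intForm_apply]
    rw [h2]
    simp [fderiv_torusChar_apply, h3]
    ring
  rw [hd, cubeMean_sub (f := fun x => torusChar (-k) x * fderiv ℝ f x v)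
    (g := fun x => (2 * π * I * intForm k v) * (torusChar (-k) x * f x))
    (hχ.continuous.mul (hs.fderiv_apply_const v).continuous)
    (continuous_const.mul hsm.continuous), sub_eq_zero] at h0
  rw [cubeCoeff, h0, cubeCoeff]
  exact integral_const_mul _ _

theorem IsZPeriodic.exists_abs_pow_mul_cubeCoeff_le (j : Fin p) (s : ℕ) :
    ∀ {f : (Fin p → ℝ) → ℂ}, IsZPeriodic f → ContDiff ℝ (⊤ : ℕ∞) f →
      ∃ C, ∀ k, |(k j : ℝ)| ^ s * ‖cubeCoeff f k‖ ≤ C := by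
  induction s with
  | zero =>
    intro f hf hs
    obtain ⟨C, hC⟩ := hf.exists_norm_le hs.continuous
    exact ⟨C, fun k => by simpa using norm_cubeCoeff_le hC k⟩
  | succ s ih =>
    intro f hf hs
    obtain ⟨C, hC⟩ := ih (hf.fderiv_apply (Pi.single j 1)) (hs.fderiv_apply_const (Pi.single j 1))
    refine ⟨C, fun k => le_trans ?_ (hC k)⟩
    have hv : intForm k (Pi.single j 1) = k j := by simp [intForm_apply, Pi.single_apply]
    rw [hf.cubeCoeff_fderiv hs, hv]
    have h2 : ‖(2 * π * I * (k j : ℝ) * cubeCoeff f k : ℂ)‖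
        = 2 * π * (|(k j : ℝ)| * ‖cubeCoeff f k‖) := by
      simp [abs_of_pos Real.pi_pos]
      ring
    rw [h2, pow_succ, mul_assoc]
    refine mul_le_mul_of_nonneg_left ?_ (by positivity)
    have : 0 ≤ |(k j : ℝ)| * ‖cubeCoeff f k‖ := by positivity
    nlinarith [Real.pi_gt_three]

theorem IsZPeriodic.exists_norm_pow_mul_cubeCoeff_le (hp : 1 ≤ p) {f : (Fin p → ℝ) → ℂ}
    (hf : IsZPeriodic f) (hs : ContDiff ℝ (⊤ : ℕ∞) f) (s : ℕ) :
    ∃ C, ∀ k : Fin p → ℤ, ‖fun i => (k i : ℝ)‖ ^ s * ‖cubeCoeff f k‖ ≤ C := by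
  choose C hC using fun j => IsZPeriodic.exists_abs_pow_mul_cubeCoeff_le j s hf hs
  refine ⟨∑ j, |C j|, fun k => ?_⟩
  have : Nonempty (Fin p) := ⟨⟨0, hp⟩⟩
  obtain ⟨j, hj⟩ := Finite.exists_max fun i => ‖(k i : ℝ)‖
  have h1 : ‖fun i => (k i : ℝ)‖ ≤ |(k j : ℝ)| := (pi_norm_le_iff_of_nonneg (norm_nonneg _)).2 hj
  calc ‖fun i => (k i : ℝ)‖ ^ s * ‖cubeCoeff f k‖ ≤ |(k j : ℝ)| ^ s * ‖cubeCoeff f k‖ := by gcongr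
    _ ≤ |C j| := (hC j k).trans (le_abs_self _)
    _ ≤ ∑ j, |C j| := Finset.single_le_sum (f := fun j => |C j|) (fun _ _ => abs_nonneg _)
        (Finset.mem_univ j)

theorem exists_summable_norm_pow_inv (p : ℕ) :
    ∃ N : ℕ, Summable fun k : Fin p → ℤ => (‖fun i => (k i : ℝ)‖ ^ N)⁻¹ := by
  let L := Submodule.span ℤ (Set.range (Pi.basisFun ℝ (Fin p)))
  refine ⟨Module.finrank ℤ L + 1, ?_⟩
  have h := ZLattice.summable_norm_pow_inv L (Module.finrank ℤ L + 1) (Nat.lt_succ_self _)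
  have hmem : ∀ k : Fin p → ℤ, (fun i => (k i : ℝ)) ∈ L := fun k => by
    rw [Module.Basis.mem_span_iff_repr_mem]
    intro i
    exact ⟨k i, by simp⟩
  have hinj : Function.Injective fun k : Fin p → ℤ => (⟨fun i => (k i : ℝ), hmem k⟩ : L) := by
    intro k k' hkk
    ext i
    have h1 : ((k i : ℤ) : ℝ) = (k' i : ℝ) := congrFun (congrArg Subtype.val hkk) i
    exact_mod_cast h1
  refine (h.comp_injective hinj).congr fun k => ?_
  rw [Function.comp_apply, inv_pow]
  rfl

theorem exists_int_abs_sub_le_norm_exp_sub_one (t : ℝ) :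
    ∃ m : ℤ, |t - m| ≤ ‖cexp (2 * π * I * t) - 1‖ := by
  refine ⟨round t, ?_⟩
  have h1 : cexp (2 * π * I * t) = cexp (I * (2 * π * (t - round t) : ℝ)) := by
    rw [Complex.exp_eq_exp_iff_exists_int]
    exact ⟨round t, by push_cast; ring⟩
  have h2 : |t - round t| ≤ 1 / 2 := abs_sub_round t
  have h3 := Real.mul_abs_le_abs_sin (x := π * (t - round t)) (by
    rw [abs_mul, abs_of_pos Real.pi_pos]
    nlinarith [Real.pi_pos])
  rw [abs_mul, abs_of_pos Real.pi_pos, ← mul_assoc, div_mul_cancel₀ _ Real.pi_ne_zero] at h3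
  rw [h1, Complex.norm_exp_I_mul_ofReal_sub_one, Real.norm_eq_abs, abs_mul, abs_two,
    show 2 * π * (t - round t) / 2 = π * (t - round t) by ring]
  have := abs_nonneg (t - round t)
  linarith

theorem norm_int_vec_ge_one {k : Fin p → ℤ} (hk : k ≠ 0) : 1 ≤ ‖fun i => (k i : ℝ)‖ := by
  obtain ⟨i, hi⟩ := Function.ne_iff.1 hk
  refine le_trans ?_ (norm_le_pi_norm (fun i => (k i : ℝ)) i)
  rw [Real.norm_eq_abs]
  exact_mod_cast Int.one_le_abs hi

theorem IsDiophantine.exists_le_norm_pow_mul {α : Fin p → ℝ} (hα : IsDiophantine α) :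
    ∃ c > (0 : ℝ), ∃ R : ℕ, ∀ k : Fin p → ℤ, k ≠ 0 →
      c ≤ ‖fun i => (k i : ℝ)‖ ^ R * ‖torusChar k α - 1‖ := by
  obtain ⟨c, hc, r, hr, h⟩ := hα
  refine ⟨c, hc, ⌈r⌉₊, fun k hk => ?_⟩
  have h1 := norm_int_vec_ge_one hk
  obtain ⟨m, hm⟩ := exists_int_abs_sub_le_norm_exp_sub_one (intForm k α)
  have h2 := (h k hk m).trans (by simpa [intForm_apply] using hm)
  set n := ‖fun i => (k i : ℝ)‖
  have h3 : n ^ r ≤ n ^ ⌈r⌉₊ := by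
    rw [← Real.rpow_natCast]
    exact Real.rpow_le_rpow_of_exponent_le h1 (Nat.le_ceil r)
  have h4 : 0 < n ^ r := Real.rpow_pos_of_pos (by linarith) r
  rw [Real.rpow_neg (by linarith), ← div_eq_mul_inv, div_le_iff₀ h4] at h2
  have h5 : ‖torusChar k α - 1‖ = ‖cexp (2 * π * I * ((∑ i, (k i : ℝ) * α i : ℝ) : ℂ)) - 1‖ := by
    rw [torusChar, intForm_apply]
  rw [h5, mul_comm]
  push_cast at h2 ⊢
  exact h2.trans (by gcongr)

theorem IsDiophantine.nat_smul {α : Fin p → ℝ} (hα : IsDiophantine α) {N : ℕ} (hN : 0 < N) :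
    IsDiophantine (N • α) := by
  obtain ⟨c, hc, r, hr, h⟩ := hα
  have hN' : (0 : ℝ) < N := by exact_mod_cast hN
  refine ⟨c * (N : ℝ) ^ (-r), by positivity, r, hr, fun k hk m => ?_⟩
  have hNk : N • k ≠ 0 := smul_ne_zero hN.ne' hk
  have h1 := h (N • k) hNk m
  have h2 : (fun i => (((N • k) i : ℤ) : ℝ)) = (N : ℝ) • fun i => (k i : ℝ) := by
    ext i; simp
  rw [h2, norm_smul, Real.norm_of_nonneg hN'.le, Real.mul_rpow hN'.le (norm_nonneg _),
    ← mul_assoc] at h1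
  convert h1 using 3
  refine Finset.sum_congr rfl fun i _ => ?_
  simp
  ring

theorem exists_cohomological_solution_complex (hp : 1 ≤ p) {α : Fin p → ℝ}
    (hα : IsDiophantine α) {f : (Fin p → ℝ) → ℂ} (hs : ContDiff ℝ (⊤ : ℕ∞) f)
    (hf : IsZPeriodic f) (h0 : cubeMean f = 0) :
    ∃ u : (Fin p → ℝ) → ℂ, ContDiff ℝ (⊤ : ℕ∞) u ∧ IsZPeriodic u ∧
      ∀ x, u (x + α) - u x = f x := by
  obtain ⟨c, hc, R, hR⟩ := hα.exists_le_norm_pow_mul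
  obtain ⟨N, hN⟩ := exists_summable_norm_pow_inv p
  have hc0 : cubeCoeff f 0 = 0 := by rw [cubeCoeff_zero, h0]
  have hsum : ∀ s : ℕ, Summable fun k : Fin p → ℤ =>
      ‖fun i => (k i : ℝ)‖ ^ s * ‖cubeCoeff f k‖ := by
    intro s
    obtain ⟨C, hC⟩ := hf.exists_norm_pow_mul_cubeCoeff_le hp hs (s + N)
    refine Summable.of_nonneg_of_le (fun k => by positivity) (fun k => ?_) (hN.mul_left |C|)
    by_cases hk : k = 0
    · rw [hk, hc0]; simp only [norm_zero, mul_zero]; positivity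
    · have h1 := norm_int_vec_ge_one hk
      rw [← div_eq_mul_inv, le_div_iff₀ (by positivity)]
      refine le_trans (le_of_eq ?_) ((hC k).trans (le_abs_self C))
      ring
  set d : (Fin p → ℤ) → ℂ := fun k => cubeCoeff f k / (torusChar k α - 1) with hd
  have hdle : ∀ k, ‖d k‖ ≤ c⁻¹ * (‖fun i => (k i : ℝ)‖ ^ R * ‖cubeCoeff f k‖) := by
    intro k
    by_cases hk : k = 0
    · simp [hd, hk, hc0]
    · have h1 := hR k hk
      have h2 := norm_int_vec_ge_one hk
      have h3 : 0 < ‖torusChar k α - 1‖ := by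
        by_contra h
        have : ‖torusChar k α - 1‖ = 0 := le_antisymm (not_lt.1 h) (norm_nonneg _)
        rw [this, mul_zero] at h1
        linarith
      rw [hd, norm_div, div_le_iff₀ h3, inv_mul_eq_div, div_mul_eq_mul_div, le_div_iff₀ hc]
      calc ‖cubeCoeff f k‖ * c
          ≤ ‖cubeCoeff f k‖ * (‖fun i => (k i : ℝ)‖ ^ R * ‖torusChar k α - 1‖) := by gcongr
        _ = _ := by ring
  have hdsum : ∀ s : ℕ, Summable fun k : Fin p → ℤ => ‖d k‖ * ‖fun i => (k i : ℝ)‖ ^ s := by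
    intro s
    refine Summable.of_nonneg_of_le (fun k => by positivity) (fun k => ?_)
      ((hsum (s + R)).mul_left c⁻¹)
    calc ‖d k‖ * ‖fun i => (k i : ℝ)‖ ^ s
        ≤ c⁻¹ * (‖fun i => (k i : ℝ)‖ ^ R * ‖cubeCoeff f k‖) * ‖fun i => (k i : ℝ)‖ ^ s := by
          gcongr; exact hdle k
      _ = _ := by ring
  have hus : ∀ x, Summable fun k => d k * torusChar k x := by
    intro x
    refine Summable.of_norm ?_
    simpa [norm_torusChar] using hdsum 0
  refine ⟨fun x => ∑' k, d k * torusChar k x, ?_, ?_, ?_⟩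
  · refine contDiff_tsum (v := fun n k => ‖d k‖ * (2 * π * p * ‖fun i => (k i : ℝ)‖) ^ n)
      (fun k => contDiff_const.mul (contDiff_torusChar k)) (fun n _ => ?_) (fun n k x _ => ?_)
    · refine ((hdsum n).mul_left ((2 * π * p) ^ n)).congr fun k => ?_
      rw [mul_pow (2 * π * p)]
      ring
    · have h1 : iteratedFDeriv ℝ n (fun x => d k * torusChar k x) x
          = d k • iteratedFDeriv ℝ n (torusChar k) x :=
        iteratedFDeriv_const_smul_apply (a := d k) (contDiff_torusChar k).contDiffAt
      rw [h1, norm_smul]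
      gcongr
      exact norm_iteratedFDeriv_torusChar_le k n x
  · intro X ℓ
    simp only [isZPeriodic_torusChar _ X ℓ]
  · intro x
    have h1 := hf.hasSum_cubeCoeff hs.continuous
      (Summable.of_norm (by simpa using hsum 0)) x
    rw [← (hus (x + α)).tsum_sub (hus x), ← h1.tsum_eq]
    refine tsum_congr fun k => ?_
    by_cases hk : k = 0
    · simp [hd, hk, hc0]
    · have h3 : torusChar k α - 1 ≠ 0 := by
        intro h
        have := hR k hk
        rw [h, norm_zero, mul_zero] at this
        linarith
      rw [torusChar_add, hd]
      field_simp

theorem exists_cohomological_solution (hp : 1 ≤ p) {α : Fin p → ℝ}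
    (hα : IsDiophantine α) {f : (Fin p → ℝ) → ℝ} (hs : ContDiff ℝ (⊤ : ℕ∞) f)
    (hf : IsZPeriodic f) (h0 : cubeMean f = 0) :
    ∃ u : (Fin p → ℝ) → ℝ, ContDiff ℝ (⊤ : ℕ∞) u ∧ IsZPeriodic u ∧ cubeMean u = 0 ∧
      ∀ x, u (x + α) - u x = f x := by
  obtain ⟨u, hu, hup, hue⟩ := exists_cohomological_solution_complex hp hα
    (f := fun x => (f x : ℂ)) (Complex.ofRealCLM.contDiff.comp hs)
    (fun X ℓ => by simp only [hf X ℓ])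
    (by have := cubeMean_comp Complex.ofRealCLM hs.continuous
        rw [h0, map_zero] at this
        exact this)
  have hre : ContDiff ℝ (⊤ : ℕ∞) fun x => (u x).re := Complex.reCLM.contDiff.comp hu
  refine ⟨fun x => (u x).re - cubeMean fun x => (u x).re, hre.sub contDiff_const,
    fun X ℓ => by simp only [hup X ℓ], ?_, fun x => ?_⟩
  · rw [cubeMean_sub hre.continuous continuous_const, cubeMean_const, sub_self]
  · have := congrArg Complex.re (hue x)
    simp only [Complex.sub_re, Complex.ofReal_re] at this
    linarith

end Fourier

section LinearAlgebra

open Polynomial in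
theorem Matrix.exists_pow_sub_one_pow_eq_zero {q : ℕ} (B : Matrix (Fin q) (Fin q) ℤ)
    (hB : ∀ z : ℂ, (B.map (Int.cast : ℤ → ℂ)).charpoly.IsRoot z → ∃ m : ℕ, 0 < m ∧ z ^ m = 1) :
    ∃ N : ℕ, 0 < N ∧ ∃ s : ℕ, (B ^ N - 1) ^ s = 0 := by
  classical
  set A : Matrix (Fin q) (Fin q) ℂ := B.map (Int.cast : ℤ → ℂ) with hA
  have hne : A.charpoly ≠ 0 := A.charpoly_monic.ne_zero
  have hm : ∀ z : ℂ, ∃ m : ℕ, 0 < m ∧ (A.charpoly.IsRoot z → z ^ m = 1) := by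
    intro z
    by_cases hz : A.charpoly.IsRoot z
    · obtain ⟨m, h0, h1⟩ := hB z hz
      exact ⟨m, h0, fun _ => h1⟩
    · exact ⟨1, one_pos, fun h => absurd h hz⟩
  choose m hm0 hm1 using hm
  set N := ∏ z ∈ A.charpoly.roots.toFinset, m z
  refine ⟨N, Finset.prod_pos fun z _ => hm0 z, A.charpoly.roots.card, ?_⟩
  have hdvd : A.charpoly ∣ (X ^ N - 1) ^ A.charpoly.roots.card := by
    have h1 : A.charpoly = (A.charpoly.roots.map fun a => X - C a).prod :=
      (IsAlgClosed.splits A.charpoly).eq_prod_roots_of_monic A.charpoly_monic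
    have h2 : (A.charpoly.roots.map fun a => X - C a).prod ∣
        (A.charpoly.roots.map fun _ => (X ^ N - 1 : ℂ[X])).prod := by
      refine Multiset.prod_dvd_prod_of_dvd _ _ fun z hz => ?_
      rw [dvd_iff_isRoot]
      have hz' : z ^ m z = 1 := hm1 z ((mem_roots hne).1 hz)
      obtain ⟨k, hk⟩ := Finset.dvd_prod_of_mem m (Multiset.mem_toFinset.2 hz)
      simp only [IsRoot.def, eval_sub, eval_pow, eval_X, eval_one]
      change z ^ (∏ z ∈ A.charpoly.roots.toFinset, m z) - 1 = 0
      rw [hk, pow_mul, hz', one_pow, sub_self]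
    rw [← h1] at h2
    simpa using h2
  have h0 : (A ^ N - 1) ^ A.charpoly.roots.card = 0 := by
    obtain ⟨r, hr⟩ := hdvd
    have := congrArg (aeval A) hr
    simpa [Matrix.aeval_self_charpoly] using this
  have hinj : Function.Injective ((Int.castRingHom ℂ).mapMatrix (m := Fin q)) :=
    Matrix.map_injective Int.cast_injective
  apply hinj
  rw [map_zero, map_pow, map_sub, map_pow, map_one]
  exact h0

theorem Matrix.exists_mulVec_eq_of_orthogonal {q : ℕ} (A : Matrix (Fin q) (Fin q) ℝ)
    (w : Fin q → ℝ) (h : ∀ v : Fin q → ℝ, Aᵀ.mulVec v = 0 → ∑ i, w i * v i = 0) :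
    ∃ g, A.mulVec g = w := by
  by_contra hw
  have hw' : w ∉ LinearMap.range A.mulVecLin := by simpa using hw
  obtain ⟨f, hf, hr⟩ := Submodule.exists_le_ker_of_notMem hw'
  have hfe : ∀ x, f x = ∑ i, x i * f (Pi.single i 1) := by
    intro x
    conv_lhs => rw [pi_eq_sum_univ' x]
    simp
  apply hf
  rw [hfe]
  refine h _ ?_
  ext j
  have h1 : f (A.mulVec (Pi.single j 1)) = 0 := hr ⟨Pi.single j 1, rfl⟩
  rw [hfe] at h1
  simpa [Matrix.mulVec, dotProduct, Pi.single_apply] using h1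

theorem Commute.sub_surjective {R V : Type*} [Ring R] [AddCommGroup V] [Module R V]
    {T M : Module.End R V} (h : Commute T M) {N s : ℕ} (hM : (M ^ N - 1) ^ s = 0)
    (hT : Function.Surjective (T ^ N - 1 : Module.End R V)) :
    Function.Surjective (T - M : Module.End R V) := by
  have hc : Commute (T ^ N - 1) (M ^ N - 1) :=
    ((h.pow_pow N N).sub_left (Commute.one_left _)).sub_right
      ((Commute.one_right _).sub_left (Commute.one_left _))
  have h1 := hc.mul_geom_sum₂ s
  have h2 := h.mul_geom_sum₂ N
  rw [hM, sub_zero, sub_sub_sub_cancel_right, ← h2, mul_assoc] at h1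
  have hs : Function.Surjective ((T ^ N - 1) ^ s : Module.End R V) := by
    rw [Module.End.coe_pow]
    exact hT.iterate s
  rw [← h1] at hs
  exact Function.Surjective.of_comp (g := _) hs

end LinearAlgebra

section SkewProduct

variable {p q : ℕ}

/-- The smooth `ℤ^p`-periodic maps `ℝ^p → ℝ^q` of zero mean. -/
def smoothPeriodicZeroMean (p q : ℕ) : Submodule ℝ ((Fin p → ℝ) → (Fin q → ℝ)) where
  carrier := {f | ContDiff ℝ (⊤ : ℕ∞) f ∧ IsZPeriodic f ∧ cubeMean f = 0}
  add_mem' := by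
    rintro f g ⟨hf, hfp, hf0⟩ ⟨hg, hgp, hg0⟩
    refine ⟨hf.add hg, fun X ℓ => ?_, ?_⟩
    · simp only [Pi.add_apply, hfp X ℓ, hgp X ℓ]
    · exact (cubeMean_add hf.continuous hg.continuous).trans (by rw [hf0, hg0, add_zero])
  zero_mem' := ⟨contDiff_const, fun _ _ => rfl, cubeMean_const 0⟩
  smul_mem' := by
    rintro c f ⟨hf, hfp, hf0⟩
    refine ⟨hf.const_smul c, fun X ℓ => ?_, ?_⟩
    · simp only [Pi.smul_apply, hfp X ℓ]
    · exact (integral_smul c f).trans ((congrArg (c • ·) hf0).trans (smul_zero c))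

/-- Translation by `α`, acting on smooth periodic maps of zero mean. -/
def translationEnd (q : ℕ) (α : Fin p → ℝ) : Module.End ℝ (smoothPeriodicZeroMean p q) where
  toFun f := ⟨fun x => f.1 (x + α), f.2.1.comp (contDiff_id.add contDiff_const),
    fun X ℓ => by simp only [add_right_comm X _ α, f.2.2.1 (X + α) ℓ],
    (f.2.2.1.cubeMean_translate α).trans f.2.2.2⟩
  map_add' _ _ := rfl
  map_smul' _ _ := rfl

/-- The action of square matrices on the values of smooth periodic maps of zero mean. -/
noncomputable def matrixEnd (p q : ℕ) :
    Matrix (Fin q) (Fin q) ℝ →+* Module.End ℝ (smoothPeriodicZeroMean p q) where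
  toFun A :=
    { toFun := fun f => ⟨fun x => A.mulVec (f.1 x),
        A.mulVecLin.toContinuousLinearMap.contDiff.comp f.2.1,
        fun X ℓ => by simp only [f.2.2.1 X ℓ],
        (cubeMean_comp A.mulVecLin.toContinuousLinearMap f.2.1.continuous).trans
          (by rw [f.2.2.2, map_zero])⟩
      map_add' := fun f g => by ext1; funext x; exact A.mulVec_add (f.1 x) (g.1 x)
      map_smul' := fun c f => by ext1; funext x; exact A.mulVec_smul c (f.1 x) }
  map_one' := by ext1 f; ext1; funext x; exact Matrix.one_mulVec (f.1 x)
  map_mul' A A' := by ext1 f; ext1; funext x; exact (Matrix.mulVec_mulVec (f.1 x) A A').symm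
  map_zero' := by ext1 f; ext1; funext x; exact Matrix.zero_mulVec (f.1 x)
  map_add' A A' := by ext1 f; ext1; funext x; exact Matrix.add_mulVec A A' (f.1 x)

theorem commute_translationEnd_matrixEnd (α : Fin p → ℝ) (A : Matrix (Fin q) (Fin q) ℝ) :
    Commute (translationEnd q α) (matrixEnd p q A) := rfl

theorem translationEnd_pow_apply (α : Fin p → ℝ) (N : ℕ) (f : smoothPeriodicZeroMean p q)
    (x : Fin p → ℝ) : ((translationEnd q α ^ N) f).1 x = f.1 (x + N • α) := by
  induction N generalizing x with
  | zero => simp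
  | succ N ih =>
    rw [pow_succ']
    change ((translationEnd q α ^ N) f).1 (x + α) = _
    rw [ih, succ_nsmul', add_assoc]

theorem surjective_translationEnd_pow_sub_one (hp : 1 ≤ p) {α : Fin p → ℝ}
    (hα : IsDiophantine α) {N : ℕ} (hN : 0 < N) :
    Function.Surjective
      (translationEnd q α ^ N - 1 : Module.End ℝ (smoothPeriodicZeroMean p q)) := by
  rintro ⟨f, hs, hf, h0⟩
  have h : ∀ i, ∃ u : (Fin p → ℝ) → ℝ, ContDiff ℝ (⊤ : ℕ∞) u ∧ IsZPeriodic u ∧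
      cubeMean u = 0 ∧ ∀ x, u (x + N • α) - u x = f x i := fun i =>
    exists_cohomological_solution hp (hα.nat_smul hN) (contDiff_pi.1 hs i)
      (fun X ℓ => by simp only [hf X ℓ])
      ((cubeMean_comp (ContinuousLinearMap.proj (R := ℝ) (φ := fun _ : Fin q => ℝ) i)
        hs.continuous).trans (by rw [h0, map_zero]))
  choose u hu hup hu0 hue using h
  have hus : ContDiff ℝ (⊤ : ℕ∞) fun x i => u i x := contDiff_pi.2 hu
  refine ⟨⟨fun x i => u i x, hus, fun X ℓ => funext fun i => hup i X ℓ, ?_⟩, ?_⟩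
  · ext i
    exact (cubeMean_comp (ContinuousLinearMap.proj (R := ℝ) (φ := fun _ : Fin q => ℝ) i)
        hus.continuous).symm.trans (hu0 i)
  · ext x i
    change ((translationEnd q α ^ N) _).1 x i - u i x = f x i
    rw [translationEnd_pow_apply]
    exact hue i x

end SkewProduct


/-- A smooth skew-product `Φ(X,Y) = (X+α, CX+BY+F(X))` on
`T^p × T^{n-p}` with Diophantine translation vector `α` and quasi-unipotent
`B ∈ GL(n−p,ℤ)` is smoothly conjugate, via `h : (X,Y) ↦ (X, Y+G(X))`, to the affine
map `Φ₀(X,Y) = (X+α, CX+BY+β₁)`, where `β₁` is the orthogonal projection of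
`β = ∫_{[0,1]^p} F` onto `ker((I−B)ᵀ)`. -/
theorem stmt6 (p q : ℕ) (hp : 1 ≤ p) (hq : 1 ≤ q)
    (α : Fin p → ℝ) (hα : IsDiophantine α)
    (C : Matrix (Fin q) (Fin p) ℤ)
    (B : Matrix (Fin q) (Fin q) ℤ) (hB : IsUnit B.det)
    (hBqu : ∀ z : ℂ, (B.map (Int.cast : ℤ → ℂ)).charpoly.IsRoot z →
      ∃ m : ℕ, 0 < m ∧ z ^ m = 1)
    (F : (Fin p → ℝ) → (Fin q → ℝ)) (hF : ContDiff ℝ (⊤ : ℕ∞) F)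
    (hFper : ∀ (X : Fin p → ℝ) (ℓ : Fin p → ℤ), F (X + fun i => (ℓ i : ℝ)) = F X)
    (β β₁ : Fin q → ℝ)
    (hβ : β = ∫ X in Set.univ.pi (fun _ : Fin p => Set.Icc (0:ℝ) 1), F X)
    (hβ₁mem : ((1 - Bᵀ).map (Int.cast : ℤ → ℝ)).mulVec β₁ = 0)
    (hβ₁orth : ∀ v : Fin q → ℝ, ((1 - Bᵀ).map (Int.cast : ℤ → ℝ)).mulVec v = 0 →
      ∑ i, (β i - β₁ i) * v i = 0) :
    ∃ G : (Fin p → ℝ) → (Fin q → ℝ), ContDiff ℝ (⊤ : ℕ∞) G ∧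
      (∀ (X : Fin p → ℝ) (ℓ : Fin p → ℤ), G (X + fun i => (ℓ i : ℝ)) = G X) ∧
      -- `h ∘ φ = φ₀ ∘ h` on the torus, read off through the lifts:
      ∀ (X : Fin p → ℝ) (Y : Fin q → ℝ),
        torusProj2 p q (X + α,
            (C.map (Int.cast : ℤ → ℝ)).mulVec X + (B.map (Int.cast : ℤ → ℝ)).mulVec Y
              + F X + G (X + α))
          = torusProj2 p q (X + α,
              (C.map (Int.cast : ℤ → ℝ)).mulVec X
                + (B.map (Int.cast : ℤ → ℝ)).mulVec (Y + G X) + β₁) := by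
  obtain ⟨N, hN, s, hBN⟩ := B.exists_pow_sub_one_pow_eq_zero hBqu
  set A : Matrix (Fin q) (Fin q) ℝ := B.map (Int.cast : ℤ → ℝ) with hA
  have hAN : (A ^ N - 1) ^ s = 0 := by
    have := congrArg ((Int.castRingHom ℝ).mapMatrix (m := Fin q)) hBN
    rwa [map_zero, map_pow, map_sub, map_pow, map_one] at this
  have hM : (matrixEnd p q A ^ N - 1) ^ s = 0 := by
    have := congrArg (matrixEnd p q) hAN
    rwa [map_zero, map_pow, map_sub, map_pow, map_one] at this
  have hsurj := (commute_translationEnd_matrixEnd α A).sub_surjective hM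
    (surjective_translationEnd_pow_sub_one hp hα hN)
  obtain ⟨g₀, hg₀⟩ := (1 - A).exists_mulVec_eq_of_orthogonal (β - β₁) fun v hv => by
    refine hβ₁orth v ?_
    convert hv using 2
    ext i j
    simp [hA, Matrix.one_apply, eq_comm]
  have hmean : cubeMean (fun X => β - F X) = 0 := by
    rw [cubeMean_sub continuous_const hF.continuous, cubeMean_const, sub_eq_zero]
    exact hβ
  obtain ⟨G, hG⟩ := hsurj ⟨fun X => β - F X, contDiff_const.sub hF,
    fun X ℓ => by simp only [hFper X ℓ], hmean⟩
  refine ⟨fun X => G.1 X - g₀, G.2.1.sub contDiff_const,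
    fun X ℓ => by simp only [G.2.2.1 X ℓ], fun X Y => ?_⟩
  have hGX : G.1 (X + α) - A.mulVec (G.1 X) = β - F X := congrFun (congrArg Subtype.val hG) X
  rw [Matrix.sub_mulVec, Matrix.one_mulVec] at hg₀
  congr 2
  rw [Matrix.mulVec_add, Matrix.mulVec_sub]
  ext i
  have h1 := congrFun hGX i
  have h2 := congrFun hg₀ i
  simp only [Pi.add_apply, Pi.sub_apply] at h1 h2 ⊢
  linarith
end

section
/- Let 1 ≤ p < n, let α ∈ ℝ^p be a Diophantine vector, let C be an (n−p)×p integer matrix, let B ∈ GL(n−p,ℤ) be quasi-unipotent, and let F : ℝ^p → ℝ^{n−p} be a C^∞ ℤ^p-periodic map. Let φ be the diffeomorphism of T^n = ℝ^n/ℤ^n defined by the lift Φ(X,Y) = (X + α, CX + BY + F(X)). If φ is minimal, then 1 is the only complex eigenvalue of the block matrix L = [[I_p, 0],[C, B]] (i.e. the linear part L of φ is unipotent). -/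
open Matrix

/-- A homeomorphism is minimal if every (two-sided) orbit is dense. -/
def IsMinimal {X : Type*} [TopologicalSpace X] (φ : X ≃ₜ X) : Prop :=
  ∀ x : X, Dense (Set.range fun k : ℤ => (φ.toEquiv ^ k) x)

section TorusAnalysis

open MeasureTheory Filter Topology UnitAddTorus

variable {d : Type*} {E : Type*}

/-- The canonical projection `ℝ^d → T^d`. -/
def toTorus (X : d → ℝ) : UnitAddTorus d := fun i => (X i : AddCircle (1 : ℝ))

lemma isOpenQuotientMap_toTorus : IsOpenQuotientMap (toTorus : (d → ℝ) → UnitAddTorus d) :=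
  IsOpenQuotientMap.piMap fun _ => QuotientAddGroup.isOpenQuotientMap_mk

lemma toTorus_add (X Y : d → ℝ) : toTorus (X + Y) = toTorus X + toTorus Y := rfl

/-- `ℤ^d`-periodicity of a function on `ℝ^d`. -/
def IntPeriodic (f : (d → ℝ) → E) : Prop :=
  ∀ (X : d → ℝ) (l : d → ℤ), f (X + fun i => (l i : ℝ)) = f X

/-- The function on the torus induced by a periodic function. -/
noncomputable def descend (f : (d → ℝ) → E) (x : UnitAddTorus d) : E :=
  f (Function.surjInv isOpenQuotientMap_toTorus.surjective x)

lemma toTorus_eq_iff {X Y : d → ℝ} :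
    toTorus X = toTorus Y ↔ ∃ l : d → ℤ, Y = X + fun i => (l i : ℝ) := by
  constructor
  · intro h
    have h1 : ∀ i, ∃ n : ℤ, (n : ℝ) = Y i - X i := fun i => by
      have := congrFun h i
      simp only [toTorus] at this
      rw [eq_comm, ← sub_eq_zero, ← AddCircle.coe_sub, AddCircle.coe_eq_zero_iff] at this
      simpa using this
    choose l hl using h1
    exact ⟨l, funext fun i => by simp [hl]⟩
  · rintro ⟨l, rfl⟩
    funext i
    simp only [toTorus, Pi.add_apply, AddCircle.coe_add, left_eq_add]
    rw [AddCircle.coe_eq_zero_iff]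
    exact ⟨l i, by simp⟩

lemma IntPeriodic.descend_toTorus {f : (d → ℝ) → E} (hf : IntPeriodic f) (X : d → ℝ) :
    descend f (toTorus X) = f X := by
  obtain ⟨l, hl⟩ := toTorus_eq_iff.1
    (Function.surjInv_eq isOpenQuotientMap_toTorus.surjective (toTorus X)).symm
  rw [descend, hl, hf]

lemma IntPeriodic.continuous_descend [TopologicalSpace E] {f : (d → ℝ) → E} (hf : IntPeriodic f)
    (hc : Continuous f) : Continuous (descend f) := by
  rw [← isOpenQuotientMap_toTorus.continuous_comp_iff]
  exact hc.congr fun X => (hf.descend_toTorus X).symm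

variable [Fintype d]

lemma mFourier_map_add (n : d → ℤ) (x y : UnitAddTorus d) :
    mFourier n (x + y) = mFourier n x * mFourier n y := by
  simp [mFourier, fourier_apply, smul_add, AddCircle.toCircle_add, Finset.prod_mul_distrib]

lemma mFourier_toTorus (n : d → ℤ) (X : d → ℝ) :
    mFourier n (toTorus X) = Complex.exp (Complex.I * ↑(2 * Real.pi * ∑ i, (n i : ℝ) * X i)) := by
  simp only [mFourier, ContinuousMap.coe_mk, toTorus, fourier_coe_apply, ← Complex.exp_sum]
  congr 1
  push_cast
  rw [Finset.mul_sum, Finset.mul_sum]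
  exact Finset.sum_congr rfl fun i _ => by ring

lemma norm_mFourier_apply (n : d → ℤ) (x : UnitAddTorus d) : ‖mFourier n x‖ = 1 := by
  simp only [mFourier, ContinuousMap.coe_mk, norm_prod, fourier_apply]
  exact Finset.prod_eq_one fun i _ => Circle.norm_coe _

/-- The normalised Haar measure on the torus. -/
noncomputable abbrev torusHaar (d : Type*) [Fintype d] : Measure (UnitAddTorus d) :=
  Measure.pi fun _ => AddCircle.haarAddCircle

lemma mFourierCoeff_eq_integral_torusHaar (f : UnitAddTorus d → ℂ) (n : d → ℤ) :
    mFourierCoeff f n = ∫ t, mFourier (-n) t * f t ∂torusHaar d := rfl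

lemma integrable_torusHaar {f : UnitAddTorus d → ℂ} (hf : Continuous f) :
    Integrable f (torusHaar d) :=
  hf.integrable_of_hasCompactSupport (HasCompactSupport.of_compactSpace f)

lemma norm_mFourierCoeff_le {f : UnitAddTorus d → ℂ} {A : ℝ} (hf : ∀ x, ‖f x‖ ≤ A) (n : d → ℤ) :
    ‖mFourierCoeff f n‖ ≤ A := by
  rw [mFourierCoeff_eq_integral_torusHaar]
  refine (norm_integral_le_of_norm_le_const (C := A) (ae_of_all _ fun x => ?_)).trans (by simp)
  simpa [norm_mFourier_apply] using hf x

lemma mFourierCoeff_comp_add_right (f : UnitAddTorus d → ℂ) (n : d → ℤ) (y : UnitAddTorus d) :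
    mFourierCoeff (fun x => f (x + y)) n = mFourier n y * mFourierCoeff f n := by
  simp only [mFourierCoeff_eq_integral_torusHaar]
  rw [← integral_const_mul,
    ← integral_add_right_eq_self (μ := torusHaar d) (fun x => _ * (_ * f x)) y]
  congr 1
  funext x
  have h : mFourier n y * mFourier (-n) y = 1 := by
    rw [← mFourier_add, add_neg_cancel, mFourier_zero]; rfl
  rw [mFourier_map_add]
  linear_combination (-(mFourier (-n) x) * f (x + y)) * h

/-- Fourier coefficients turn directional derivatives into multiplications. -/
lemma mFourierCoeff_descend_fderiv {H : (d → ℝ) → ℂ} (hH : ContDiff ℝ 1 H) (hp : IntPeriodic H)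
    (V : d → ℝ) (hp' : IntPeriodic fun X => fderiv ℝ H X V) (n : d → ℤ) :
    mFourierCoeff (descend fun X => fderiv ℝ H X V) n =
      Complex.I * ↑(2 * Real.pi * ∑ i, (n i : ℝ) * V i) * mFourierCoeff (descend H) n := by
  have hc : Continuous (descend H) := hp.continuous_descend hH.continuous
  have hcont' : Continuous fun X => fderiv ℝ H X V :=
    (hH.continuous_fderiv one_ne_zero).clm_apply continuous_const
  have hc' : Continuous (descend fun X => fderiv ℝ H X V) := hp'.continuous_descend hcont'
  obtain ⟨A, hA⟩ : ∃ A, ∀ x, ‖descend (fun X => fderiv ℝ H X V) x‖ ≤ A := by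
    obtain ⟨A, hA⟩ := isCompact_univ.exists_bound_of_continuousOn hc'.continuousOn
    exact ⟨A, fun x => hA x trivial⟩
  have hdiff : ∀ (x : UnitAddTorus d) (t : ℝ),
      HasDerivAt (fun t : ℝ => mFourier (-n) x * descend H (x + toTorus (t • V)))
        (mFourier (-n) x * descend (fun X => fderiv ℝ H X V) (x + toTorus (t • V))) t := by
    intro x t
    obtain ⟨X, rfl⟩ := isOpenQuotientMap_toTorus.surjective x
    simp only [← toTorus_add, hp.descend_toTorus, hp'.descend_toTorus]
    refine HasDerivAt.const_mul _ ?_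
    have h1 : HasDerivAt (fun t : ℝ => X + t • V) V t := by
      simpa using ((hasDerivAt_id t).smul_const V).const_add X
    exact ((hH.differentiable one_ne_zero (X + t • V)).hasFDerivAt).comp_hasDerivAt t h1
  have key := (hasDerivAt_integral_of_dominated_loc_of_deriv_le (μ := torusHaar d) (x₀ := (0 : ℝ))
    (F := fun (t : ℝ) x => mFourier (-n) x * descend H (x + toTorus (t • V)))
    (F' := fun (t : ℝ) x =>
      mFourier (-n) x * descend (fun X => fderiv ℝ H X V) (x + toTorus (t • V)))
    (s := Set.univ) (bound := fun _ => A) univ_mem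
    (Eventually.of_forall fun t => Continuous.aestronglyMeasurable (by fun_prop))
    (integrable_torusHaar (by fun_prop)) (Continuous.aestronglyMeasurable (by fun_prop))
    (ae_of_all _ fun x t _ => by simpa [norm_mFourier_apply] using hA _)
    (integrable_const A) (ae_of_all _ fun x t _ => hdiff x t)).2
  simp only [zero_smul, ← mFourierCoeff_eq_integral_torusHaar, mFourierCoeff_comp_add_right] at key
  simp only [mFourier_toTorus] at key
  have h2 : HasDerivAt (fun t : ℝ => Complex.exp (Complex.I *
      ↑(2 * Real.pi * ∑ i, (n i : ℝ) * (t • V) i)) * mFourierCoeff (descend H) n)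
      (Complex.I * ↑(2 * Real.pi * ∑ i, (n i : ℝ) * V i) * mFourierCoeff (descend H) n) 0 := by
    refine HasDerivAt.mul_const ?_ _
    have h3 : HasDerivAt (fun t : ℝ => Complex.I *
        ↑(2 * Real.pi * ∑ i, (n i : ℝ) * (t • V) i))
        (Complex.I * ↑(2 * Real.pi * ∑ i, (n i : ℝ) * V i)) 0 := by
      have h4 := ((hasDerivAt_id (0 : ℝ)).ofReal_comp.const_mul
        (Complex.I * ↑(2 * Real.pi * ∑ i, (n i : ℝ) * V i)))
      simp only [Complex.ofReal_one, mul_one, id] at h4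
      refine h4.congr_of_eventuallyEq (Eventually.of_forall fun t => ?_)
      have : ∑ i, (n i : ℝ) * (t • V) i = t * ∑ i, (n i : ℝ) * V i := by
        rw [Finset.mul_sum]
        exact Finset.sum_congr rfl fun i _ => by simp; ring
      simp only [this]
      push_cast
      ring
    simpa using h3.cexp
  simpa using key.unique h2

lemma IntPeriodic.fderiv_apply {H : (d → ℝ) → ℂ} (hp : IntPeriodic H) (V : d → ℝ) :
    IntPeriodic fun X => fderiv ℝ H X V := by
  intro X l
  have h : (fun Y => H (Y + fun i => (l i : ℝ))) = H := funext fun Y => hp Y l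
  simp only
  rw [← fderiv_comp_add_right, h]

lemma exists_abs_pow_mul_norm_mFourierCoeff_le (j : d) (N : ℕ) :
    ∀ {H : (d → ℝ) → ℂ}, ContDiff ℝ (⊤ : ℕ∞) H → IntPeriodic H →
      ∃ A : ℝ, 0 ≤ A ∧ ∀ n : d → ℤ, |(n j : ℝ)| ^ N * ‖mFourierCoeff (descend H) n‖ ≤ A := by
  classical
  induction N with
  | zero =>
    intro H hH hp
    obtain ⟨A, hA⟩ := isCompact_univ.exists_bound_of_continuousOn
      (hp.continuous_descend hH.continuous).continuousOn
    exact ⟨A, (norm_nonneg _).trans (hA 0 trivial), fun n => by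
      simpa using norm_mFourierCoeff_le (fun x => hA x trivial) n⟩
  | succ N ih =>
    intro H hH hp
    have hp' := hp.fderiv_apply (Pi.single j 1)
    obtain ⟨A, hA0, hA⟩ := ih (H := fun X => fderiv ℝ H X (Pi.single j 1))
      ((hH.fderiv_right (m := (⊤ : ℕ∞)) (by simp)).clm_apply contDiff_const) hp'
    refine ⟨A, hA0, fun n => le_trans ?_ (hA n)⟩
    rw [mFourierCoeff_descend_fderiv (hH.of_le (by simp)) hp _ hp']
    have hs : ∑ i, (n i : ℝ) * (Pi.single j (1 : ℝ) : d → ℝ) i = n j := by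
      simp [Pi.single_apply]
    rw [hs, norm_mul, norm_mul, Complex.norm_I, one_mul, Complex.norm_real, Real.norm_eq_abs,
      abs_mul, abs_of_pos Real.two_pi_pos, pow_succ]
    have h1 : (1 : ℝ) ≤ 2 * Real.pi := by linarith [Real.pi_gt_three]
    calc _ = 1 * (|(n j : ℝ)| ^ N * |(n j : ℝ)| * ‖mFourierCoeff (descend H) n‖) := by ring
      _ ≤ 2 * Real.pi * (|(n j : ℝ)| ^ N * |(n j : ℝ)| * ‖mFourierCoeff (descend H) n‖) := by
        gcongr
      _ = _ := by ring

/-- The Fourier coefficients of a smooth function decay faster than any power. -/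
lemma exists_norm_pow_mul_norm_mFourierCoeff_le [Nonempty d] (N : ℕ) {H : (d → ℝ) → ℂ}
    (hH : ContDiff ℝ (⊤ : ℕ∞) H) (hp : IntPeriodic H) :
    ∃ A : ℝ, 0 ≤ A ∧ ∀ n : d → ℤ,
      ‖(fun i => (n i : ℝ))‖ ^ N * ‖mFourierCoeff (descend H) n‖ ≤ A := by
  choose A hA0 hA using fun j => exists_abs_pow_mul_norm_mFourierCoeff_le j N hH hp
  refine ⟨∑ j, A j, Finset.sum_nonneg fun j _ => hA0 j, fun n => ?_⟩
  obtain ⟨j, hj⟩ := Finite.exists_max fun i => |(n i : ℝ)|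
  have hn : ‖(fun i => (n i : ℝ))‖ ≤ |(n j : ℝ)| :=
    (pi_norm_le_iff_of_nonneg (abs_nonneg _)).2 hj
  calc _ ≤ |(n j : ℝ)| ^ N * ‖mFourierCoeff (descend H) n‖ := by gcongr
    _ ≤ A j := hA j n
    _ ≤ _ := Finset.single_le_sum (fun i _ => hA0 i) (Finset.mem_univ j)

lemma summable_norm_intCast_rpow {r : ℝ} (hr : r < -Fintype.card d) :
    Summable fun n : d → ℤ => ‖(fun i => (n i : ℝ))‖ ^ r := by
  let L : Submodule ℤ (d → ℝ) := Submodule.span ℤ (Set.range (Pi.basisFun ℝ d))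
  have hrank : Module.finrank ℤ L = Fintype.card d := by
    rw [ZLattice.rank ℝ L, Module.finrank_fintype_fun_eq_card]
  have hmem : ∀ n : d → ℤ, (fun i => (n i : ℝ)) ∈ L := fun n => by
    rw [(Pi.basisFun ℝ d).mem_span_iff_repr_mem ℤ]
    exact fun i => ⟨n i, by simp⟩
  have h := ZLattice.summable_norm_rpow L r (by rwa [hrank])
  refine h.comp_injective (i := fun n : d → ℤ => (⟨_, hmem n⟩ : L)) fun m n hmn => ?_
  funext i
  simpa using congrFun (congrArg Subtype.val hmn) i

lemma four_mul_le_norm_exp_sub_one {x δ : ℝ} (h : ∀ m : ℤ, δ ≤ |x - m|) :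
    4 * δ ≤ ‖Complex.exp (Complex.I * ↑(2 * Real.pi * x)) - 1‖ := by
  have h1 : Complex.exp (Complex.I * ↑(2 * Real.pi * x)) =
      Complex.exp (Complex.I * ↑(2 * Real.pi * (x - round x))) := by
    rw [Complex.exp_eq_exp_iff_exists_int]
    exact ⟨round x, by push_cast; ring⟩
  rw [h1, Complex.norm_exp_I_mul_ofReal_sub_one, norm_mul, Real.norm_eq_abs, Real.norm_eq_abs]
  have h2 : 2 * Real.pi * (x - round x) / 2 = Real.pi * (x - round x) := by ring
  have h3 : |Real.pi * (x - round x)| ≤ Real.pi / 2 := by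
    rw [abs_mul, abs_of_pos Real.pi_pos]
    have := abs_sub_round x
    nlinarith [Real.pi_pos]
  have h4 := Real.mul_abs_le_abs_sin h3
  rw [abs_mul, abs_of_pos Real.pi_pos] at h4
  rw [h2, abs_of_pos (two_pos : (0 : ℝ) < 2)]
  have h5 : 2 / Real.pi * (Real.pi * |x - round x|) = 2 * |x - round x| := by
    field_simp
  have := h (round x)
  linarith

end TorusAnalysis

/-- Over a Diophantine translation, every smooth function is a constant plus a continuous
coboundary. -/
theorem IsDiophantine.exists_coboundary {p : ℕ} (hp : 1 ≤ p) {β : Fin p → ℝ}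
    (hβ : IsDiophantine β) {H : (Fin p → ℝ) → ℝ} (hH : ContDiff ℝ (⊤ : ℕ∞) H)
    (hper : IntPeriodic H) :
    ∃ (a : ℝ) (g : UnitAddTorus (Fin p) → ℝ), Continuous g ∧
      ∀ X, H X = a + (g (toTorus (X + β)) - g (toTorus X)) := by
  have : Nonempty (Fin p) := ⟨⟨0, hp⟩⟩
  obtain ⟨c, hc, r, hr, hdio⟩ := hβ
  let K : (Fin p → ℝ) → ℂ := fun X => (H X : ℂ)
  have hK : ContDiff ℝ (⊤ : ℕ∞) K := Complex.ofRealCLM.contDiff.comp hH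
  have hKp : IntPeriodic K := fun X l => congrArg Complex.ofReal (hper X l)
  let e : (Fin p → ℤ) → ℂ := fun n => UnitAddTorus.mFourier n (toTorus β)
  let b : (Fin p → ℤ) → ℂ := fun n => UnitAddTorus.mFourierCoeff (descend K) n
  let s : (Fin p → ℤ) → ℂ := fun n => b n / (e n - 1)
  have he0 : e 0 = 1 := by simp only [e, UnitAddTorus.mFourier_zero]; rfl
  have he : ∀ n ≠ 0, 4 * (c * ‖(fun i => (n i : ℝ))‖ ^ (-r)) ≤ ‖e n - 1‖ := fun n hn => by
    simp only [e, mFourier_toTorus]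
    exact four_mul_le_norm_exp_sub_one (hdio n hn)
  have hnpos : ∀ n : Fin p → ℤ, n ≠ 0 → 0 < ‖(fun i => (n i : ℝ))‖ := fun n hn => by
    rw [norm_pos_iff]
    exact fun h => hn (funext fun i => by simpa using congrFun h i)
  have hene : ∀ n ≠ 0, e n - 1 ≠ 0 := fun n hn => by
    rw [← norm_pos_iff]
    have := Real.rpow_pos_of_pos (hnpos n hn) (-r)
    exact lt_of_lt_of_le (by positivity) (he n hn)
  obtain ⟨N, hN⟩ := exists_nat_gt (r + p)
  obtain ⟨A, hA0, hA⟩ := exists_norm_pow_mul_norm_mFourierCoeff_le N hK hKp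
  have hs : Summable s := by
    refine Summable.of_norm_bounded ((summable_norm_intCast_rpow (d := Fin p) (r := r - N)
      (by rw [Fintype.card_fin]; linarith)).mul_left (A / (4 * c))) fun n => ?_
    rcases eq_or_ne n 0 with rfl | hn
    · simp only [s, he0, sub_self, div_zero, norm_zero]
      positivity
    · have h1 := he n hn
      have h2 := hA n
      have h3 := hnpos n hn
      simp only [s, norm_div]
      rw [div_le_iff₀ (norm_pos_iff.2 (hene n hn))]
      generalize ‖(fun i => (n i : ℝ))‖ = t at h1 h2 h3 ⊢
      have h4 : ‖b n‖ ≤ A * t ^ (-(N : ℝ)) := by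
        rw [Real.rpow_neg h3.le, Real.rpow_natCast, ← div_eq_mul_inv, le_div_iff₀ (by positivity)]
        linarith
      have h5 : t ^ (r - N) * t ^ (-r) = t ^ (-(N : ℝ)) := by
        rw [← Real.rpow_add h3]
        congr 1
        ring
      calc ‖b n‖ ≤ A * t ^ (-(N : ℝ)) := h4
        _ = A / (4 * c) * t ^ (r - N) * (4 * (c * t ^ (-r))) := by
          rw [← h5]
          field_simp
        _ ≤ _ := by gcongr
  have hbs : ∀ n, b n = s n * (e n - 1) + if n = 0 then b 0 else 0 := fun n => by
    rcases eq_or_ne n 0 with rfl | hn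
    · simp [he0]
    · simp [s, hn, hene n hn]
  have hen : ∀ n, ‖e n‖ = 1 := fun n => norm_mFourier_apply n _
  have hse : Summable fun n => s n * (e n - 1) := by
    refine Summable.of_norm_bounded (hs.norm.mul_right 2) fun n => ?_
    rw [norm_mul]
    gcongr
    calc ‖e n - 1‖ ≤ ‖e n‖ + ‖(1 : ℂ)‖ := norm_sub_le _ _
      _ = 2 := by rw [hen, norm_one]; norm_num
  have hb : Summable b := by
    rw [show b = fun n => s n * (e n - 1) + if n = 0 then b 0 else 0 from funext hbs]
    exact hse.add (hasSum_ite_eq 0 (b 0)).summable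
  let f : C(UnitAddTorus (Fin p), ℂ) := ⟨descend K, hKp.continuous_descend hK.continuous⟩
  have hsx : ∀ x : UnitAddTorus (Fin p), Summable fun n => s n * UnitAddTorus.mFourier n x :=
    fun x => Summable.of_norm_bounded hs.norm fun n => by
      rw [norm_mul, norm_mFourier_apply, mul_one]
  let g : UnitAddTorus (Fin p) → ℂ := fun x => ∑' n, s n * UnitAddTorus.mFourier n x
  have hg : Continuous g := continuous_tsum (fun n => by fun_prop) hs.norm fun n x => by
    rw [norm_mul, norm_mFourier_apply, mul_one]
  refine ⟨(b 0).re, fun x => (g x).re, Complex.continuous_re.comp hg, fun X => ?_⟩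
  have h1 : HasSum (fun n => b n * UnitAddTorus.mFourier n (toTorus X)) (K X) := by
    rw [← hKp.descend_toTorus X]
    exact UnitAddTorus.hasSum_mFourier_series_apply_of_summable (f := f) hb (toTorus X)
  have h2 : HasSum (fun n => b n * UnitAddTorus.mFourier n (toTorus X))
      (g (toTorus (X + β)) - g (toTorus X) + b 0) := by
    refine (((hsx _).hasSum.sub (hsx _).hasSum).add (hasSum_ite_eq (0 : Fin p → ℤ) (b 0))).congr_fun
      fun n => ?_
    rw [toTorus_add, mFourier_map_add]
    conv_lhs => rw [hbs n]
    rcases eq_or_ne n 0 with rfl | hn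
    · simp [he0, e, UnitAddTorus.mFourier_zero]
    · simp only [hn, if_false, e]
      ring
  have h3 := congrArg Complex.re (h1.unique h2)
  simp only [K, Complex.ofReal_re, Complex.add_re, Complex.sub_re] at h3
  rw [h3]
  ring

lemma IsDiophantine.natCast_smul {p : ℕ} {α : Fin p → ℝ} (hα : IsDiophantine α) {m : ℕ}
    (hm : 0 < m) : IsDiophantine ((m : ℝ) • α) := by
  obtain ⟨c, hc, r, hr, h⟩ := hα
  have hm' : (0 : ℝ) < m := by exact_mod_cast hm
  refine ⟨c * (m : ℝ) ^ (-r), by positivity, r, hr, fun k hk l => ?_⟩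
  have h1 := h ((m : ℤ) • k) (smul_ne_zero (by exact_mod_cast hm.ne') hk) l
  have h2 : (fun i => ((((m : ℤ) • k) i : ℤ) : ℝ)) = (m : ℝ) • fun i => (k i : ℝ) :=
    funext fun i => by simp
  rw [h2, norm_smul, Real.mul_rpow (norm_nonneg _) (norm_nonneg _), ← mul_assoc,
    Real.norm_of_nonneg hm'.le] at h1
  refine h1.trans_eq (congrArg (fun t => |t - (l : ℝ)|) (Finset.sum_congr rfl fun i _ => ?_))
  simp
  ring

lemma exists_vecMul_geom_sum_eq_zero {q : ℕ} {B : Matrix (Fin q) (Fin q) ℤ} {z : ℂ}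
    (hz : (B.map (Int.cast : ℤ → ℂ)).charpoly.IsRoot z) (hz1 : z ≠ 1) {m : ℕ} (hzm : z ^ m = 1) :
    ∃ w : Fin q → ℤ, w ≠ 0 ∧ w ᵥ* (∑ i ∈ Finset.range m, B ^ i) = 0 := by
  rw [Matrix.exists_vecMul_eq_zero_iff]
  have hroot : (∑ i ∈ Finset.range m, (Polynomial.X : Polynomial ℂ) ^ i).IsRoot z := by
    have h := geom_sum_mul z m
    rw [hzm, sub_self] at h
    simpa [Polynomial.eval_finsetSum] using (mul_eq_zero.1 h).resolve_right (sub_ne_zero.2 hz1)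
  obtain ⟨Q, hQ⟩ := Polynomial.dvd_iff_isRoot.2 hroot
  have h1 := congrArg (Polynomial.aeval (B.map (Int.cast : ℤ → ℂ))) hQ
  simp only [map_sum, map_pow, Polynomial.aeval_X, map_mul, map_sub, Polynomial.aeval_C] at h1
  have h2 : (B.map (Int.cast : ℤ → ℂ) - algebraMap ℂ _ z).det = 0 := by
    have h3 := hz
    rw [Polynomial.IsRoot, Matrix.eval_charpoly] at h3
    rw [← neg_sub, Matrix.det_neg]
    exact mul_eq_zero_of_right _ h3
  have h4 : ((∑ i ∈ Finset.range m, B ^ i).map (Int.cast : ℤ → ℂ)) =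
      ∑ i ∈ Finset.range m, (B.map (Int.cast : ℤ → ℂ)) ^ i := by
    have := map_sum (Int.castRingHom ℂ).mapMatrix (fun i => B ^ i) (Finset.range m)
    simp only [map_pow] at this
    exact this
  have h5 : ((∑ i ∈ Finset.range m, B ^ i).det : ℂ) = 0 := by
    refine ((Int.castRingHom ℂ).map_det _).trans ?_
    refine (congrArg Matrix.det (h4.trans h1)).trans ?_
    rw [Matrix.det_mul, h2, zero_mul]
  exact_mod_cast h5

/-- A continuous observable invariant under a power of a minimal homeomorphism takes only finitely
many values. -/
lemma IsMinimal.finite_range {X Y : Type*} [TopologicalSpace X] [TopologicalSpace Y] [T1Space Y]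
    {φ : X ≃ₜ X} (hφ : IsMinimal φ) {u : X → Y} (hu : Continuous u) {m : ℕ} (hm : 0 < m)
    (hinv : ∀ x, u (φ^[m] x) = u x) : (Set.range u).Finite := by
  rcases isEmpty_or_nonempty X with _ | ⟨⟨x⟩⟩
  · exact Set.finite_range u
  have h1 : ∀ y, u ((φ.toEquiv ^ (m : ℤ)) y) = u y := fun y => by
    rw [zpow_natCast, ← hinv y, Equiv.Perm.coe_pow]
    rfl
  have h2 : ∀ (k : ℤ) y, u (((φ.toEquiv ^ (m : ℤ)) ^ k) y) = u y := by
    intro k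
    induction k with
    | zero => simp
    | succ k ih => intro y; rw [_root_.zpow_add_one, Equiv.Perm.mul_apply, ih, h1]
    | pred k ih =>
      intro y
      rw [_root_.zpow_sub_one, Equiv.Perm.mul_apply, ih, ← h1, ← Equiv.Perm.mul_apply, mul_inv_cancel,
        Equiv.Perm.one_apply]
  let S : Set Y := (fun k : ℤ => u ((φ.toEquiv ^ k) x)) '' Set.Ico 0 (m : ℤ)
  have hS : S.Finite := (Set.finite_Ico _ _).image _
  have hm' : (0 : ℤ) < m := by exact_mod_cast hm
  have hsub : Set.range (fun k : ℤ => (φ.toEquiv ^ k) x) ⊆ u ⁻¹' S := by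
    rintro _ ⟨k, rfl⟩
    refine ⟨k % m, ⟨Int.emod_nonneg _ hm'.ne', Int.emod_lt_of_pos _ hm'⟩, ?_⟩
    simp only
    conv_rhs => rw [← Int.mul_ediv_add_emod k m, _root_.zpow_add, _root_.zpow_mul, Equiv.Perm.mul_apply, h2]
  have hclosed := (hS.isClosed.preimage hu).closure_subset_iff.2 hsub
  rw [(hφ x).closure_eq] at hclosed
  exact hS.subset (Set.range_subset_iff.2 fun y => hclosed trivial)

section SkewProduct

variable {p q : ℕ} {α : Fin p → ℝ} {C : Matrix (Fin q) (Fin p) ℤ} {B : Matrix (Fin q) (Fin q) ℤ}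
  {F : (Fin p → ℝ) → (Fin q → ℝ)} {φ : Torus2 p q ≃ₜ Torus2 p q}

/-- The real row vector `w Bⁿ`. -/
def rowPow (B : Matrix (Fin q) (Fin q) ℤ) (w : Fin q → ℤ) (n : ℕ) : Fin q → ℝ :=
  fun i => ((w ᵥ* B ^ n) i : ℝ)

lemma rowPow_succ (w : Fin q → ℤ) (n : ℕ) :
    rowPow B w (n + 1) = rowPow B w n ᵥ* B.map (Int.cast : ℤ → ℝ) := by
  funext i
  simp only [rowPow, pow_succ, ← Matrix.vecMul_vecMul]
  simp [rowPow, Matrix.vecMul, dotProduct]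

lemma exists_iterate_lift
    (hlift : ∀ (X : Fin p → ℝ) (Y : Fin q → ℝ),
      torusProj2 p q (X + α,
          (C.map (Int.cast : ℤ → ℝ)).mulVec X + (B.map (Int.cast : ℤ → ℝ)).mulVec Y + F X)
        = φ (torusProj2 p q (X, Y)))
    (w : Fin q → ℤ) (m : ℕ) (X : Fin p → ℝ) (Y : Fin q → ℝ) (n : ℕ) (hn : n ≤ m) :
    ∃ Y' : Fin q → ℝ, φ^[n] (torusProj2 p q (X, Y)) = torusProj2 p q (X + (n : ℝ) • α, Y') ∧
      rowPow B w (m - n) ⬝ᵥ Y' = rowPow B w m ⬝ᵥ Y + ∑ j ∈ Finset.range n,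
        rowPow B w (m - 1 - j) ⬝ᵥ
          ((C.map (Int.cast : ℤ → ℝ)).mulVec (X + (j : ℝ) • α) + F (X + (j : ℝ) • α)) := by
  induction n with
  | zero => exact ⟨Y, by simp, by simp⟩
  | succ n ih =>
    obtain ⟨Y', h1, h2⟩ := ih (by omega)
    refine ⟨(C.map (Int.cast : ℤ → ℝ)).mulVec (X + (n : ℝ) • α) +
      (B.map (Int.cast : ℤ → ℝ)).mulVec Y' + F (X + (n : ℝ) • α), ?_, ?_⟩
    · rw [Function.iterate_succ_apply', h1, ← hlift]
      congr 2
      push_cast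
      rw [add_smul, one_smul, add_assoc]
    · rw [Finset.sum_range_succ, ← add_assoc, ← h2]
      obtain ⟨k, rfl⟩ := Nat.exists_eq_add_of_lt (Nat.lt_of_succ_le hn)
      have e1 : n + k + 1 - (n + 1) = k := by omega
      have e2 : n + k + 1 - n = k + 1 := by omega
      have e3 : n + k + 1 - 1 - n = k := by omega
      rw [e1, e2, e3, rowPow_succ, ← Matrix.dotProduct_mulVec]
      simp only [dotProduct_add]
      ring

/-- If `w (1 + B + ⋯ + B^(m-1)) = 0`, the `m`-th power of the skew product has an invariant
observable whose restriction to the fibres is the character `m w`. -/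
lemma exists_invariant_observable (hp : 1 ≤ p) (hα : IsDiophantine α)
    (hF : ContDiff ℝ (⊤ : ℕ∞) F)
    (hFper : ∀ (X : Fin p → ℝ) (l : Fin p → ℤ), F (X + fun i => (l i : ℝ)) = F X)
    (hlift : ∀ (X : Fin p → ℝ) (Y : Fin q → ℝ),
      torusProj2 p q (X + α,
          (C.map (Int.cast : ℤ → ℝ)).mulVec X + (B.map (Int.cast : ℤ → ℝ)).mulVec Y + F X)
        = φ (torusProj2 p q (X, Y)))
    {m : ℕ} (hm : 0 < m) {w : Fin q → ℤ} (hw : w ᵥ* (∑ i ∈ Finset.range m, B ^ i) = 0) :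
    ∃ u : Torus2 p q → AddCircle (1 : ℝ), Continuous u ∧ (∀ x, u (φ^[m] x) = u x) ∧
      ∃ v : (Fin p → ℝ) → ℝ, ∀ X Y,
        u (torusProj2 p q (X, Y)) = ((m * ∑ i, (w i : ℝ) * Y i + v X : ℝ) : AddCircle (1 : ℝ)) := by
  have hFi : ∀ i, ContDiff ℝ (⊤ : ℕ∞) fun X => F X i := contDiff_pi.1 hF
  choose a g hg hag using fun i => (hα.natCast_smul hm).exists_coboundary hp (hFi i)
    fun X l => congrFun (hFper X l) i
  have hperiod : rowPow B w m = rowPow B w 0 := by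
    have h := congrArg (w ᵥ* ·) (geom_sum_mul B m)
    simp only [← Matrix.vecMul_vecMul, hw, Matrix.zero_vecMul, Matrix.vecMul_sub,
      Matrix.vecMul_one] at h
    funext i
    simp only [rowPow, pow_zero, Matrix.vecMul_one]
    rw [sub_eq_zero.1 h.symm]
  have hsum : ∑ j ∈ Finset.range m, rowPow B w (m - 1 - j) = 0 := by
    rw [Finset.sum_range_reflect (rowPow B w) m]
    funext i
    have h := congrFun hw i
    rw [Matrix.vecMul_sum, Finset.sum_apply] at h
    simp only [rowPow, Finset.sum_apply, Pi.zero_apply]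
    exact_mod_cast h
  let l : Fin p → ℤ := ∑ j ∈ Finset.range m, (j : ℤ) • ((w ᵥ* B ^ (m - 1 - j)) ᵥ* C)
  let G : UnitAddTorus (Fin p) → ℝ := fun x =>
    ∑ j ∈ Finset.range m, ∑ i, rowPow B w (m - 1 - j) i * g i (x + toTorus ((j : ℝ) • α))
  have hG : Continuous G := by fun_prop
  let u : Torus2 p q → AddCircle (1 : ℝ) := fun x =>
    ∑ i, (m * w i) • x.2 i - ∑ i, l i • x.1 i - ((m * G x.1 : ℝ) : AddCircle (1 : ℝ))
  have hu : ∀ X Y, u (torusProj2 p q (X, Y)) = ((m * ∑ i, (w i : ℝ) * Y i +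
      (-∑ i, (l i : ℝ) * X i - m * G (toTorus X)) : ℝ) : AddCircle (1 : ℝ)) := by
    intro X Y
    have hsumcoe : ∀ {k : ℕ} (c : Fin k → ℤ) (Z : Fin k → ℝ),
        ∑ i, c i • (Z i : AddCircle (1 : ℝ)) = ((∑ i, (c i : ℝ) * Z i : ℝ) : AddCircle (1 : ℝ)) :=
      fun c Z => by
        simp only [← zsmul_eq_mul, ← AddCircle.coe_zsmul]
        exact (map_sum (QuotientAddGroup.mk' (AddSubgroup.zmultiples (1 : ℝ))) _ _).symm
    simp only [u, torusProj2]
    rw [hsumcoe (fun i => m * w i) Y, hsumcoe l X, ← AddCircle.coe_sub, ← AddCircle.coe_sub]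
    congr 1
    have hw' : ∑ i, ((m * w i : ℤ) : ℝ) * Y i = m * ∑ i, (w i : ℝ) * Y i := by
      rw [Finset.mul_sum]
      exact Finset.sum_congr rfl fun i _ => by push_cast; ring
    rw [hw']
    change _ - m * G (toTorus X) = _
    ring
  have hproj : Function.Surjective (torusProj2 p q) := fun x => by
    obtain ⟨X, hX⟩ := isOpenQuotientMap_toTorus.surjective x.1
    obtain ⟨Y, hY⟩ := isOpenQuotientMap_toTorus.surjective x.2
    exact ⟨(X, Y), Prod.ext hX hY⟩
  refine ⟨u, by fun_prop, fun x => ?_, _, hu⟩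
  obtain ⟨⟨X, Y⟩, rfl⟩ := hproj x
  obtain ⟨Y', h1, h2⟩ := exists_iterate_lift hlift w m X Y m le_rfl
  rw [h1, hu, hu]
  congr 1
  rw [Nat.sub_self, hperiod] at h2
  have hrow : ∀ Z : Fin q → ℝ, ∑ i, (w i : ℝ) * Z i = rowPow B w 0 ⬝ᵥ Z := fun Z => by
    simp [rowPow, dotProduct]
  have hC : ∑ j ∈ Finset.range m, rowPow B w (m - 1 - j) ⬝ᵥ
      (C.map (Int.cast : ℤ → ℝ)).mulVec (X + (j : ℝ) • α) = ∑ i, (l i : ℝ) * α i := by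
    have hl : ∑ i, (l i : ℝ) * α i = ∑ j ∈ Finset.range m, (j : ℝ) *
        (rowPow B w (m - 1 - j) ⬝ᵥ (C.map (Int.cast : ℤ → ℝ)).mulVec α) := by
      simp only [Matrix.dotProduct_mulVec]
      simp only [l, dotProduct, Finset.sum_apply, Int.cast_sum,
        Finset.sum_mul, Finset.mul_sum]
      rw [Finset.sum_comm]
      refine Finset.sum_congr rfl fun j _ => Finset.sum_congr rfl fun i _ => ?_
      simp only [Pi.smul_apply, smul_eq_mul, Int.cast_mul, Int.cast_natCast, mul_assoc]
      congr 2
      simp [rowPow, Matrix.vecMul, dotProduct]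
    rw [hl]
    simp only [Matrix.mulVec_add, Matrix.mulVec_smul, dotProduct_add, dotProduct_smul,
      smul_eq_mul, Finset.sum_add_distrib]
    rw [← sum_dotProduct, hsum, zero_dotProduct, zero_add]
  have hFsum : ∑ j ∈ Finset.range m, rowPow B w (m - 1 - j) ⬝ᵥ F (X + (j : ℝ) • α) =
      G (toTorus (X + (m : ℝ) • α)) - G (toTorus X) := by
    have hFa : ∀ j : ℕ, rowPow B w (m - 1 - j) ⬝ᵥ F (X + (j : ℝ) • α) =
        rowPow B w (m - 1 - j) ⬝ᵥ a +
        ((∑ i, rowPow B w (m - 1 - j) i *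
          g i (toTorus (X + (m : ℝ) • α) + toTorus ((j : ℝ) • α))) -
        ∑ i, rowPow B w (m - 1 - j) i * g i (toTorus X + toTorus ((j : ℝ) • α))) := fun j => by
      simp only [dotProduct, ← Finset.sum_sub_distrib, ← Finset.sum_add_distrib, ← toTorus_add]
      refine Finset.sum_congr rfl fun i _ => ?_
      rw [hag i, add_right_comm]
      ring
    simp only [hFa, Finset.sum_add_distrib, Finset.sum_sub_distrib, G]
    rw [← sum_dotProduct, hsum, zero_dotProduct, zero_add]
  simp only [dotProduct_add, Finset.sum_add_distrib] at h2
  rw [hC, hFsum, ← hrow, ← hrow] at h2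
  rw [h2]
  simp only [Pi.add_apply, Pi.smul_apply, smul_eq_mul, mul_add, Finset.sum_add_distrib]
  have hlm : ∑ i, (l i : ℝ) * ((m : ℝ) * α i) = m * ∑ i, (l i : ℝ) * α i := by
    rw [Finset.mul_sum]
    exact Finset.sum_congr rfl fun i _ => by ring
  rw [hlm]
  ring

end SkewProduct

/-- If a smooth skew-product `Φ(X,Y) = (X+α, CX+BY+F(X))` on
`T^p × T^{n-p}`, with Diophantine translation vector `α` and quasi-unipotent
`B ∈ GL(n−p,ℤ)`, is minimal, then `1` is the only complex eigenvalue of its linear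
part `L = [[I,0],[C,B]]`. -/
theorem stmt7 (p q : ℕ) (hp : 1 ≤ p) (hq : 1 ≤ q)
    (α : Fin p → ℝ) (hα : IsDiophantine α)
    (C : Matrix (Fin q) (Fin p) ℤ)
    (B : Matrix (Fin q) (Fin q) ℤ) (hB : IsUnit B.det)
    (hBqu : ∀ z : ℂ, (B.map (Int.cast : ℤ → ℂ)).charpoly.IsRoot z →
      ∃ m : ℕ, 0 < m ∧ z ^ m = 1)
    (F : (Fin p → ℝ) → (Fin q → ℝ)) (hF : ContDiff ℝ (⊤ : ℕ∞) F)
    (hFper : ∀ (X : Fin p → ℝ) (ℓ : Fin p → ℤ), F (X + fun i => (ℓ i : ℝ)) = F X)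
    (φ : Torus2 p q ≃ₜ Torus2 p q)
    (hlift : ∀ (X : Fin p → ℝ) (Y : Fin q → ℝ),
      torusProj2 p q (X + α,
          (C.map (Int.cast : ℤ → ℝ)).mulVec X + (B.map (Int.cast : ℤ → ℝ)).mulVec Y + F X)
        = φ (torusProj2 p q (X, Y)))
    (hmin : IsMinimal φ) :
    ∀ z : ℂ,
      ((Matrix.fromBlocks (1 : Matrix (Fin p) (Fin p) ℤ) 0 C B).map
        (Int.cast : ℤ → ℂ)).charpoly.IsRoot z → z = 1 := by
  intro z hz
  by_contra hz1
  have hzB : (B.map (Int.cast : ℤ → ℂ)).charpoly.IsRoot z := by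
    rw [Matrix.fromBlocks_map, Matrix.map_zero _ Int.cast_zero, Matrix.charpoly_fromBlocks_zero₁₂,
      Matrix.map_one _ Int.cast_zero Int.cast_one, Matrix.charpoly_one, Polynomial.root_mul] at hz
    refine hz.resolve_left fun h => hz1 ?_
    rw [Polynomial.IsRoot, Polynomial.eval_pow] at h
    simpa [sub_eq_zero] using eq_zero_of_pow_eq_zero h
  obtain ⟨m, hm, hzm⟩ := hBqu z hzB
  obtain ⟨w, hw0, hw⟩ := exists_vecMul_geom_sum_eq_zero hzB hz1 hzm
  obtain ⟨u, hu, hinv, v, huv⟩ := exists_invariant_observable hp hα hF hFper hlift hm hw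
  obtain ⟨i, hi⟩ := Function.ne_iff.1 hw0
  have hsurj : Function.Surjective u := fun t => by
    obtain ⟨s, rfl⟩ := QuotientAddGroup.mk_surjective t
    refine ⟨torusProj2 p q (0, Pi.single i ((s - v 0) / (m * w i))), ?_⟩
    have hi' : (w i : ℝ) ≠ 0 := by exact_mod_cast hi
    have hm' : (m : ℝ) ≠ 0 := by exact_mod_cast hm.ne'
    rw [huv]
    congr 1
    simp only [Pi.single_apply, mul_ite, mul_zero, Finset.sum_ite_eq', Finset.mem_univ, if_true]
    field_simp
    ring
  have hfin := hmin.finite_range hu hm hinv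
  rw [hsurj.range_eq] at hfin
  have : Nontrivial (AddCircle (1 : ℝ)) := by
    refine ⟨((1 / 2 : ℝ) : AddCircle (1 : ℝ)), 0, fun h => ?_⟩
    obtain ⟨n, hn⟩ := (AddCircle.coe_eq_zero_iff _).1 h
    have h2 : (2 * n : ℝ) = 1 := by
      rw [zsmul_eq_mul] at hn
      linarith
    have h3 : 2 * n = 1 := by exact_mod_cast h2
    omega
  have : Infinite (AddCircle (1 : ℝ)) := PreconnectedSpace.infinite
  exact Set.infinite_univ hfin
end
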